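/- arXiv:2405.18160 — 5 statements merged into one kernel-verified Lean document; each statement's English description precedes it below -/
import Mathlib

section
/- Assume in addition that ∫ Q(z, z̃) dz̃ = 1 for all z and ∫ P_z(x, y) dy = 1 for all z, x, and that 𝒵 := ∫_{ℝ^d} exp(−βV(z, x^⊥)) dz dx^⊥ ∈ (0,∞). With 𝒬_a as above, the measure π(du dv) = 𝒵^{−1} 𝒬_a(u, v) du dv + δ_u(dv) (𝒵^{−1} exp(−βV(u)) − 𝒵^{−1} ∫ 𝒬_a(u, w) dw) du on (ℝ^ℓ × ℝ^{d−ℓ})² is well defined (in particular ∫ 𝒬_a(u, w) dw ≤ exp(−βV(u)) for all u) and is invariant under the swap (u, v) ↦ (v, u). Consequently, the Markov chain generated by the asymmetric path algorithm is reversible with respect to ν(du) = 𝒵^{−1} exp(−βV(u)) du. -/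
open MeasureTheory

/-- The path `(ξ_0, ξ_1, …, ξ_{K-1}, ξ_K)` with fixed endpoints `ξ_0 = a`,
`ξ_K = b` and interior points `ξ_k = η_{k-1}` for `1 ≤ k ≤ K − 1`. -/
def pathFun {X : Type*} (K : ℕ) (a b : X) (η : Fin (K - 1) → X) : ℕ → X :=
  fun k => if h : 1 ≤ k ∧ k < K then η ⟨k - 1, by omega⟩ else if k = 0 then a else b

open scoped ENNReal

section

variable {X : Type*}

theorem pathFun_eq_right {K : ℕ} (hK : 1 ≤ K) (a b : X) (η : Fin (K - 1) → X) :
    pathFun K a b η K = b := by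
  have : K ≠ 0 := by omega
  simp [pathFun, this]

theorem pathFun_congr_right {K k : ℕ} (hk : k < K) (a b b' : X) (η : Fin (K - 1) → X) :
    pathFun K a b η k = pathFun K a b' η k := by
  unfold pathFun
  split_ifs <;> first | rfl | omega

/-- Appending a point to the interior of a path does not change its initial segment. -/
theorem pathFun_snoc {n k : ℕ} (hk : k ≤ n + 1) (a b c : X) (η : Fin n → X) :
    pathFun (n + 2) a c (Fin.snoc (α := fun _ => X) η b : Fin (n + 1) → X) k =
      pathFun (n + 1) a b η k := by
  unfold pathFun
  split_ifs with h₁ h₂ h₃ h₄ <;> try first | rfl | omega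
  · exact Fin.snoc_castSucc (α := fun _ => X) (i := ⟨k - 1, by omega⟩) b η
  · obtain rfl : k = n + 1 := by omega
    exact Fin.snoc_last (α := fun _ => X) b η

/-- Time reversal of a path. -/
theorem pathFun_rev {K k : ℕ} (hK : 1 ≤ K) (hk : k ≤ K) (a b : X) (η : Fin (K - 1) → X) :
    pathFun K b a (fun i => η i.rev) k = pathFun K a b η (K - k) := by
  unfold pathFun
  split_ifs <;> try first | rfl | omega
  refine congrArg η (Fin.ext ?_)
  simp only [Fin.val_rev]
  omega

theorem measurable_pathFun [MeasurableSpace X] (K : ℕ) (a : X) (k : ℕ) :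
    Measurable fun q : X × (Fin (K - 1) → X) => pathFun K a q.1 q.2 k := by
  unfold pathFun
  split_ifs <;> fun_prop

/-- The product of sub-Markov transition densities along a path has total mass at most one
when the initial point is fixed. -/
theorem lintegral_prod_pathFun_le_one [MeasureSpace X] [SigmaFinite (volume : Measure X)]
    {p : ℕ → X → X → ℝ≥0∞} (hp : ∀ k, Measurable (Function.uncurry (p k)))
    (hp_le : ∀ k x, ∫⁻ y, p k x y ≤ 1) (a : X) (n : ℕ) :
    ∫⁻ b, ∫⁻ η : Fin n → X, ∏ k ∈ Finset.Icc 1 (n + 1),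
      p k (pathFun (n + 1) a b η (k - 1)) (pathFun (n + 1) a b η k) ≤ 1 := by
  have hmeas : Measurable fun q : X × (Fin n → X) => ∏ k ∈ Finset.Icc 1 (n + 1),
      p k (pathFun (n + 1) a q.1 q.2 (k - 1)) (pathFun (n + 1) a q.1 q.2 k) :=
    Finset.measurable_prod _ fun k _ => (hp k).comp
      ((measurable_pathFun (n + 1) a (k - 1)).prodMk (measurable_pathFun (n + 1) a k))
  rw [lintegral_lintegral_swap hmeas.aemeasurable]
  calc
    _ ≤ ∫⁻ η : Fin n → X, ∏ k ∈ Finset.Icc 1 n,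
        p k (pathFun (n + 1) a a η (k - 1)) (pathFun (n + 1) a a η k) := by
      refine lintegral_mono fun η => ?_
      have hsplit (b : X) : ∏ k ∈ Finset.Icc 1 (n + 1),
          p k (pathFun (n + 1) a b η (k - 1)) (pathFun (n + 1) a b η k) =
          (∏ k ∈ Finset.Icc 1 n,
            p k (pathFun (n + 1) a a η (k - 1)) (pathFun (n + 1) a a η k)) *
          p (n + 1) (pathFun (n + 1) a a η n) b := by
        rw [Finset.prod_Icc_succ_top (by omega), pathFun_eq_right (by omega),
          Nat.add_sub_cancel, pathFun_congr_right n.lt_succ_self a b a η]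
        congr 1
        refine Finset.prod_congr rfl fun k hk => ?_
        rw [Finset.mem_Icc] at hk
        rw [pathFun_congr_right (K := n + 1) (k := k - 1) (by omega) a b a η,
          pathFun_congr_right (K := n + 1) (k := k) (by omega) a b a η]
      simp_rw [hsplit]
      rw [lintegral_const_mul _ ((hp _).of_uncurry_left)]
      exact mul_le_of_le_one_right' (hp_le _ _)
    _ ≤ 1 := by
      cases n with
      | zero => simp [volume_pi]
      | succ m =>
        have hsnoc := (volume_preserving_piFinSuccAbove (fun _ : Fin (m + 1) => X)
          (Fin.last m)).symm
        rw [← hsnoc.lintegral_comp_emb (MeasurableEquiv.measurableEmbedding _)]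
        refine (lintegral_prod_le _).trans ?_
        refine le_of_eq_of_le ?_ (lintegral_prod_pathFun_le_one hp hp_le a m)
        refine lintegral_congr fun b => lintegral_congr fun η => ?_
        refine Finset.prod_congr rfl fun k hk => ?_
        rw [Finset.mem_Icc] at hk
        have h (j : ℕ) (hj : j ≤ m + 1) : pathFun (m + 1 + 1) a a
            ((MeasurableEquiv.piFinSuccAbove (fun _ : Fin (m + 1) => X) (Fin.last m)).symm
              (b, η)) j = pathFun (m + 1) a b η j := by
          rw [← pathFun_snoc hj a b a η, MeasurableEquiv.piFinSuccAbove_symm_apply]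
          simp [Fin.insertNthEquiv]
        rw [h _ (by omega), h _ (by omega)]

theorem ofReal_integral_le_lintegral_ofReal {α : Type*} [MeasurableSpace α] {μ : Measure α}
    {f : α → ℝ} (hf : ∀ x, 0 ≤ f x) :
    ENNReal.ofReal (∫ x, f x ∂μ) ≤ ∫⁻ x, ENNReal.ofReal (f x) ∂μ := by
  have h := enorm_integral_le_lintegral_enorm (μ := μ) f
  rw [Real.enorm_of_nonneg (integral_nonneg hf)] at h
  simpa only [Real.enorm_of_nonneg (hf _)] using h

theorem lintegral_ofReal_eq_one {α : Type*} [MeasurableSpace α] {μ : Measure α}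
    {f : α → ℝ} (hf : ∀ x, 0 ≤ f x) (h : ∫ x, f x ∂μ = 1) :
    ∫⁻ x, ENNReal.ofReal (f x) ∂μ = 1 := by
  have hint : Integrable f μ := by
    by_contra hn
    simp [integral_undef hn] at h
  rw [← ofReal_integral_eq_lintegral_ofReal hint (Filter.Eventually.of_forall hf), h,
    ENNReal.ofReal_one]

theorem map_swap_withDensity_of_symm {α : Type*} [MeasureSpace α]
    [SFinite (volume : Measure α)] {f : α × α → ℝ≥0∞} (hf : ∀ q, f q.swap = f q) :
    Measure.map Prod.swap (((volume : Measure α).prod volume).withDensity f) =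
      ((volume : Measure α).prod volume).withDensity f := by
  ext s hs
  rw [Measure.map_apply measurable_swap hs, withDensity_apply _ (measurable_swap hs),
    withDensity_apply _ hs,
    ← (Measure.measurePreserving_swap (μ := (volume : Measure α))
      (ν := volume)).setLIntegral_comp_preimage_emb
        MeasurableEquiv.prodComm.measurableEmbedding f s]
  simp_rw [hf]

theorem map_swap_map_diag {α : Type*} [MeasurableSpace α] (μ : Measure α) :
    Measure.map Prod.swap (Measure.map (fun u => (u, u)) μ) =
      Measure.map (fun u => (u, u)) μ := by
  rw [Measure.map_map measurable_swap (by fun_prop)]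
  rfl

theorem integral_comp_rev [MeasureSpace X] [SigmaFinite (volume : Measure X)] (n : ℕ)
    (f : (Fin n → X) → ℝ) : ∫ η : Fin n → X, f (fun i => η i.rev) = ∫ η, f η := by
  rw [← (volume_measurePreserving_piCongrLeft (fun _ => X)
    (Fin.revPerm (n := n))).integral_comp' f]
  refine integral_congr_ae (Filter.Eventually.of_forall fun η => congrArg f (funext fun i => ?_))
  obtain ⟨j, rfl⟩ := Fin.revPerm.surjective i
  refine Eq.trans ?_ (Equiv.piCongrLeft_apply_apply (fun _ => X) Fin.revPerm η j).symm
  simp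

end

/-- Reversibility of the asymmetric path algorithm: with `𝒬_a` the accepted-move
joint density, one has `∫ 𝒬_a(u, ·) ≤ exp(−βV(u))`, so the joint law `π` of
`(X_n, X_{n+1})` (off-diagonal density `𝒵⁻¹ 𝒬_a` plus the diagonal rejection
part) is well defined; it is invariant under the swap `(u, v) ↦ (v, u)`,
i.e. the chain is reversible with respect to `ν = 𝒵⁻¹ exp(−βV) du`. -/
theorem stmt4 (ℓ d : ℕ) (hℓ : 0 < ℓ) (hld : ℓ < d)
    (β : ℝ) (hβ : 0 < β)
    (V : (Fin ℓ → ℝ) → (Fin (d - ℓ) → ℝ) → ℝ)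
    (hV : Measurable (Function.uncurry V))
    (Zc : ℝ)
    (hZc : Zc = ∫ x : (Fin ℓ → ℝ) × (Fin (d - ℓ) → ℝ), Real.exp (-β * V x.1 x.2))
    (hZpos : 0 < Zc)
    (hZfin : Integrable (fun x : (Fin ℓ → ℝ) × (Fin (d - ℓ) → ℝ) =>
      Real.exp (-β * V x.1 x.2)))
    (Q : (Fin ℓ → ℝ) → (Fin ℓ → ℝ) → ℝ)
    (hQmeas : Measurable (Function.uncurry Q))
    (hQnonneg : ∀ z z', 0 ≤ Q z z')
    (hQnorm : ∀ z, ∫ z', Q z z' = 1)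
    (P : (Fin ℓ → ℝ) → (Fin (d - ℓ) → ℝ) → (Fin (d - ℓ) → ℝ) → ℝ)
    (hPmeas : Measurable (fun q : (Fin ℓ → ℝ) × (Fin (d - ℓ) → ℝ) × (Fin (d - ℓ) → ℝ) =>
      P q.1 q.2.1 q.2.2))
    (hPnonneg : ∀ z x y, 0 ≤ P z x y)
    (hPnorm : ∀ z x, (∫ y, P z x y) = 1)
    (K : ℕ) (hK : 1 ≤ K)
    (zbar : ℕ → (Fin ℓ → ℝ) → (Fin ℓ → ℝ) → (Fin ℓ → ℝ))
    (hzbarmeas : ∀ k, Measurable (Function.uncurry (zbar k)))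
    (hzbar0 : ∀ a b, zbar 0 a b = a)
    (hzbarK : ∀ a b, zbar K a b = b)
    (Qa : ((Fin ℓ → ℝ) × (Fin (d - ℓ) → ℝ)) →
      ((Fin ℓ → ℝ) × (Fin (d - ℓ) → ℝ)) → ℝ)
    (hQa : ∀ u v, Qa u v =
      ∫ η : Fin (K - 1) → (Fin (d - ℓ) → ℝ),
        min
          (Real.exp (-β * V u.1 u.2) * Q u.1 v.1 *
            ∏ k ∈ Finset.Icc 1 K,
              P (zbar k u.1 v.1) (pathFun K u.2 v.2 η (k - 1)) (pathFun K u.2 v.2 η k))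
          (Real.exp (-β * V v.1 v.2) * Q v.1 u.1 *
            ∏ k ∈ Finset.Icc 1 K,
              P (zbar k v.1 u.1) (pathFun K u.2 v.2 η (K - k + 1))
                (pathFun K u.2 v.2 η (K - k)))) :
    (∀ u, (∫ w, Qa u w) ≤ Real.exp (-β * V u.1 u.2)) ∧
    (Measure.map Prod.swap
        ((volume.prod volume).withDensity
            (fun q => ENNReal.ofReal (Zc⁻¹ * Qa q.1 q.2)) +
          Measure.map (fun u => (u, u))
            (volume.withDensity fun u =>
              ENNReal.ofReal (Zc⁻¹ * Real.exp (-β * V u.1 u.2)) -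
                ENNReal.ofReal (Zc⁻¹ * ∫ w, Qa u w))) =
      (volume.prod volume).withDensity
          (fun q => ENNReal.ofReal (Zc⁻¹ * Qa q.1 q.2)) +
        Measure.map (fun u => (u, u))
          (volume.withDensity fun u =>
            ENNReal.ofReal (Zc⁻¹ * Real.exp (-β * V u.1 u.2)) -
              ENNReal.ofReal (Zc⁻¹ * ∫ w, Qa u w))) := by
  have hmin_nonneg (u v : (Fin ℓ → ℝ) × (Fin (d - ℓ) → ℝ)) (η) :
      0 ≤ min
          (Real.exp (-β * V u.1 u.2) * Q u.1 v.1 *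
            ∏ k ∈ Finset.Icc 1 K,
              P (zbar k u.1 v.1) (pathFun K u.2 v.2 η (k - 1)) (pathFun K u.2 v.2 η k))
          (Real.exp (-β * V v.1 v.2) * Q v.1 u.1 *
            ∏ k ∈ Finset.Icc 1 K,
              P (zbar k v.1 u.1) (pathFun K u.2 v.2 η (K - k + 1))
                (pathFun K u.2 v.2 η (K - k))) :=
    le_min
      (mul_nonneg (mul_nonneg (Real.exp_pos _).le (hQnonneg _ _))
        (Finset.prod_nonneg fun _ _ => hPnonneg _ _ _))
      (mul_nonneg (mul_nonneg (Real.exp_pos _).le (hQnonneg _ _))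
        (Finset.prod_nonneg fun _ _ => hPnonneg _ _ _))
  have hQa_nonneg (u v) : 0 ≤ Qa u v := by
    rw [hQa]
    exact integral_nonneg (hmin_nonneg u v)
  have hQa_symm (u v) : Qa u v = Qa v u := by
    rw [hQa u v, hQa v u, ← integral_comp_rev (K - 1)]
    refine integral_congr_ae (Filter.Eventually.of_forall fun η => ?_)
    dsimp only
    rw [min_comm]
    congr 2 <;> refine Finset.prod_congr rfl fun k hk => ?_ <;> rw [Finset.mem_Icc] at hk <;>
      rw [pathFun_rev hK (by omega), pathFun_rev hK (by omega)] <;> congr 1 <;> congr 1 <;> omega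
  have hQa_le (u v) : ENNReal.ofReal (Qa u v) ≤
      ENNReal.ofReal (Real.exp (-β * V u.1 u.2)) * (ENNReal.ofReal (Q u.1 v.1) *
        ∫⁻ η : Fin (K - 1) → (Fin (d - ℓ) → ℝ), ∏ k ∈ Finset.Icc 1 K,
          ENNReal.ofReal (P (zbar k u.1 v.1)
            (pathFun K u.2 v.2 η (k - 1)) (pathFun K u.2 v.2 η k))) := by
    rw [hQa, ← mul_assoc, ← ENNReal.ofReal_mul (Real.exp_pos _).le,
      ← lintegral_const_mul' _ _ ENNReal.ofReal_ne_top]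
    refine (ofReal_integral_le_lintegral_ofReal (hmin_nonneg u v)).trans
      (lintegral_mono fun η => ?_)
    dsimp only
    rw [← ENNReal.ofReal_prod_of_nonneg fun _ _ => hPnonneg _ _ _,
      ← ENNReal.ofReal_mul (mul_nonneg (Real.exp_pos _).le (hQnonneg _ _))]
    exact ENNReal.ofReal_le_ofReal (min_le_left _ _)
  have hpath (u : (Fin ℓ → ℝ) × (Fin (d - ℓ) → ℝ)) (z : Fin ℓ → ℝ) :
      ∫⁻ b, ∫⁻ η : Fin (K - 1) → (Fin (d - ℓ) → ℝ), ∏ k ∈ Finset.Icc 1 K,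
          ENNReal.ofReal (P (zbar k u.1 z)
            (pathFun K u.2 b η (k - 1)) (pathFun K u.2 b η k)) ≤ 1 := by
    obtain ⟨n, rfl⟩ : ∃ n, K = n + 1 := ⟨K - 1, by omega⟩
    refine lintegral_prod_pathFun_le_one
      (p := fun k x y => ENNReal.ofReal (P (zbar k u.1 z) x y)) (fun k => ?_)
      (fun k x => (lintegral_ofReal_eq_one (hPnonneg _ _) (hPnorm _ _)).le) u.2 n
    exact (hPmeas.comp (measurable_const.prodMk measurable_id)).ennreal_ofReal
  refine ⟨fun u => ?_, ?_⟩
  · rw [← ENNReal.ofReal_le_ofReal_iff (Real.exp_pos _).le]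
    calc
      ENNReal.ofReal (∫ w, Qa u w) ≤ ∫⁻ w, ENNReal.ofReal (Qa u w) :=
        ofReal_integral_le_lintegral_ofReal (hQa_nonneg u)
      _ ≤ ∫⁻ w, _ := lintegral_mono (hQa_le u)
      _ ≤ ENNReal.ofReal (Real.exp (-β * V u.1 u.2)) := by
        rw [lintegral_const_mul' _ _ ENNReal.ofReal_ne_top]
        refine mul_le_of_le_one_right' ((lintegral_prod_le _).trans ?_)
        rw [← lintegral_ofReal_eq_one (hQnonneg u.1) (hQnorm u.1)]
        refine lintegral_mono fun z => ?_
        dsimp only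
        rw [lintegral_const_mul' _ _ ENNReal.ofReal_ne_top]
        exact mul_le_of_le_one_right' (hpath u z)
  · rw [Measure.map_add _ _ measurable_swap, map_swap_map_diag,
      map_swap_withDensity_of_symm fun q => by rw [Prod.fst_swap, Prod.snd_swap, hQa_symm]]
end

section
/- Assume the schedule symmetry z̄_k(a, b) = z̄_{K−k}(b, a) for all a, b ∈ ℝ^ℓ and all k ∈ {0, …, K}, and that each kernel is strictly positive and reversible with respect to the conditional Boltzmann densities: P_z(x, y) > 0 and P_z(x, y) exp(−βV(z, x)) = P_z(y, x) exp(−βV(z, y)) for all z ∈ ℝ^ℓ and x, y ∈ ℝ^{d−ℓ}. Then for all z, z̃ ∈ ℝ^ℓ and all ξ₀, …, ξ_K ∈ ℝ^{d−ℓ}, [ exp(−βV(z̃, ξ_K)) ∏_{k=0}^{K−1} P_{z̄_k(z̃, z)}(ξ_{K−k}, ξ_{K−k−1}) ] / [ exp(−βV(z, ξ₀)) ∏_{k=1}^{K} P_{z̄_k(z, z̃)}(ξ_{k−1}, ξ_k) ] = exp( −β ∑_{k=0}^{K−1} [ V(z̄_{k+1}(z, z̃), ξ_k) − V(z̄_k(z,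 z̃), ξ_k) ] ). In other words, the acceptance ratio of the coin algorithm in the case C = 1 equals exp(−β𝒲¹) where 𝒲¹ is the Jarzynski-type work along the forward path. -/
open MeasureTheory

/-- Unnormalised Jarzynski identity along a path `ξ` with parameter schedule `s`: for kernels
reversible with respect to `exp (-β * V z ·)`, the backward path weight is the forward path weight
times the exponential of the work. -/
theorem backward_weight_eq_exp_work_mul_forward_weight {Z X : Type*} (β : ℝ) (V : Z → X → ℝ)
    (P : Z → X → X → ℝ)
    (hP : ∀ z x y, P z x y * Real.exp (-β * V z x) = P z y x * Real.exp (-β * V z y))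
    (s : ℕ → Z) (ξ : ℕ → X) (n : ℕ) :
    Real.exp (-β * V (s n) (ξ n)) * ∏ i ∈ Finset.range n, P (s (i + 1)) (ξ (i + 1)) (ξ i) =
      Real.exp (-β * ∑ i ∈ Finset.range n, (V (s (i + 1)) (ξ i) - V (s i) (ξ i))) *
        (Real.exp (-β * V (s 0) (ξ 0)) *
          ∏ i ∈ Finset.range n, P (s (i + 1)) (ξ i) (ξ (i + 1))) := by
  induction n with
  | zero => simp
  | succ n ih =>
    have hrev := hP (s (n + 1)) (ξ (n + 1)) (ξ n)
    have hwork : Real.exp (-β * V (s (n + 1)) (ξ n)) =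
        Real.exp (-β * (V (s (n + 1)) (ξ n) - V (s n) (ξ n))) *
          Real.exp (-β * V (s n) (ξ n)) := by
      rw [← Real.exp_add]
      ring_nf
    rw [hwork] at hrev
    rw [Finset.prod_range_succ, Finset.prod_range_succ, Finset.sum_range_succ, mul_add,
      Real.exp_add]
    linear_combination (∏ i ∈ Finset.range n, P (s (i + 1)) (ξ (i + 1)) (ξ i)) * hrev +
      P (s (n + 1)) (ξ n) (ξ (n + 1)) *
        Real.exp (-β * (V (s (n + 1)) (ξ n) - V (s n) (ξ n))) * ih

/-- The acceptance ratio of the coin algorithm for coin value `C = 1` equals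
`exp(−β𝒲¹)` with the Jarzynski-type work
`𝒲¹ = ∑_{k=0}^{K−1} [V(z̄_{k+1}(z, z̃), ξ_k) − V(z̄_k(z, z̃), ξ_k)]`,
assuming the schedule symmetry `z̄_k(a,b) = z̄_{K−k}(b,a)` and that each kernel
`P_z` is strictly positive and reversible with respect to the conditional
Boltzmann density `exp(−βV(z, ·))`. -/
theorem stmt9 (ℓ d : ℕ) (hℓ : 0 < ℓ) (hld : ℓ < d)
    (β : ℝ) (hβ : 0 < β)
    (V : (Fin ℓ → ℝ) → (Fin (d - ℓ) → ℝ) → ℝ)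
    (hV : Measurable (Function.uncurry V))
    (P : (Fin ℓ → ℝ) → (Fin (d - ℓ) → ℝ) → (Fin (d - ℓ) → ℝ) → ℝ)
    (hPmeas : Measurable (fun q : (Fin ℓ → ℝ) × (Fin (d - ℓ) → ℝ) × (Fin (d - ℓ) → ℝ) =>
      P q.1 q.2.1 q.2.2))
    (K : ℕ) (hK : 1 ≤ K)
    (zbar : ℕ → (Fin ℓ → ℝ) → (Fin ℓ → ℝ) → (Fin ℓ → ℝ))
    (hzbarmeas : ∀ k, Measurable (Function.uncurry (zbar k)))
    (hzbar0 : ∀ a b, zbar 0 a b = a)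
    (hzbarK : ∀ a b, zbar K a b = b)
    (hzbarsymm : ∀ (a b : Fin ℓ → ℝ) (k : ℕ), k ≤ K → zbar k a b = zbar (K - k) b a)
    (hPpos : ∀ z x y, 0 < P z x y)
    (hPrev : ∀ z x y, P z x y * Real.exp (-β * V z x) = P z y x * Real.exp (-β * V z y)) :
    ∀ (z z' : Fin ℓ → ℝ) (ξ : ℕ → (Fin (d - ℓ) → ℝ)),
      (Real.exp (-β * V z' (ξ K)) *
          ∏ k ∈ Finset.range K, P (zbar k z' z) (ξ (K - k)) (ξ (K - k - 1))) /
        (Real.exp (-β * V z (ξ 0)) *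
          ∏ k ∈ Finset.Icc 1 K, P (zbar k z z') (ξ (k - 1)) (ξ k)) =
      Real.exp (-β * ∑ k ∈ Finset.range K,
        (V (zbar (k + 1) z z') (ξ k) - V (zbar k z z') (ξ k))) := by
  intro z z' ξ
  have hback : ∏ k ∈ Finset.range K, P (zbar k z' z) (ξ (K - k)) (ξ (K - k - 1)) =
      ∏ i ∈ Finset.range K, P (zbar (i + 1) z z') (ξ (i + 1)) (ξ i) := by
    rw [← Finset.prod_range_reflect (fun i => P (zbar (i + 1) z z') (ξ (i + 1)) (ξ i))]
    refine Finset.prod_congr rfl fun k hk => ?_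
    have hk' : k < K := Finset.mem_range.mp hk
    rw [hzbarsymm z' z k hk'.le, show K - 1 - k + 1 = K - k by omega,
      show K - 1 - k = K - k - 1 by omega]
  have hforw : ∏ k ∈ Finset.Icc 1 K, P (zbar k z z') (ξ (k - 1)) (ξ k) =
      ∏ i ∈ Finset.range K, P (zbar (i + 1) z z') (ξ i) (ξ (i + 1)) := by
    rw [Finset.range_eq_Ico]
    exact (Finset.prod_Ico_add' (fun k => P (zbar k z z') (ξ (k - 1)) (ξ k)) 0 K 1).symm
  have hjar := backward_weight_eq_exp_work_mul_forward_weight β V P hPrev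
    (fun k => zbar k z z') ξ K
  simp only [hzbar0, hzbarK] at hjar
  have hpos : 0 < Real.exp (-β * V z (ξ 0)) *
      ∏ i ∈ Finset.range K, P (zbar (i + 1) z z') (ξ i) (ξ (i + 1)) :=
    mul_pos (Real.exp_pos _) (Finset.prod_pos fun _ _ => hPpos _ _ _)
  rw [hback, hforw, div_eq_iff hpos.ne']
  exact hjar
end

section
/- Assume the schedule symmetry z̄_k(a, b) = z̄_{K−k}(b, a) for all a, b ∈ ℝ^ℓ and all k ∈ {0, …, K}, and that each kernel is strictly positive and reversible with respect to the conditional Boltzmann densities: P_z(x, y) > 0 and P_z(x, y) exp(−βV(z, x)) = P_z(y, x) exp(−βV(z, y)) for all z ∈ ℝ^ℓ and x, y ∈ ℝ^{d−ℓ}. Then for all z, z̃ ∈ ℝ^ℓ and all ξ₀, …, ξ_K ∈ ℝ^{d−ℓ}, [ exp(−βV(z̃, ξ_K)) ∏_{k=0}^{K−1} P_{z̄_{k+1}(z̃, z)}(ξ_{K−k}, ξ_{K−k−1}) ] / [ exp(−βV(z, ξ₀)) ∏_{k=1}^{K} P_{z̄_{k−1}(z, z̃)}(ξ_{k−1}, ξ_k)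 ] = exp( −β ∑_{k=0}^{K−1} [ V(z̄_{k+1}(z, z̃), ξ_{k+1}) − V(z̄_k(z, z̃), ξ_{k+1}) ] ). In other words, the acceptance ratio of the coin algorithm in the case C = 0 equals exp(−β𝒲⁰) where 𝒲⁰ is the Jarzynski-type work along the forward path. -/
open MeasureTheory

/-- Along a path `ξ` driven by a schedule `w`, reversibility turns the weighted density of the
reversed path into the weighted density of the path times the exponential of minus `β` times the
work. -/
theorem exp_mul_prod_reverse_eq_exp_work_mul {Z X : Type*} (β : ℝ) (V : Z → X → ℝ)
    (P : Z → X → X → ℝ)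
    (hP : ∀ z x y, P z x y * Real.exp (-β * V z x) = P z y x * Real.exp (-β * V z y))
    (w : ℕ → Z) (ξ : ℕ → X) (n : ℕ) :
    Real.exp (-β * V (w n) (ξ n)) * ∏ k ∈ Finset.range n, P (w k) (ξ (k + 1)) (ξ k) =
      Real.exp (-β * ∑ k ∈ Finset.range n,
          (V (w (k + 1)) (ξ (k + 1)) - V (w k) (ξ (k + 1)))) *
        (Real.exp (-β * V (w 0) (ξ 0)) *
          ∏ k ∈ Finset.range n, P (w k) (ξ k) (ξ (k + 1))) := by
  induction n with
  | zero => simp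
  | succ n ih =>
    have hwork : Real.exp (-β * V (w (n + 1)) (ξ (n + 1))) =
        Real.exp (-β * (V (w (n + 1)) (ξ (n + 1)) - V (w n) (ξ (n + 1)))) *
          Real.exp (-β * V (w n) (ξ (n + 1))) := by
      rw [← Real.exp_add]
      ring_nf
    rw [Finset.prod_range_succ, Finset.prod_range_succ, Finset.sum_range_succ, mul_add,
      Real.exp_add, hwork]
    linear_combination
      Real.exp (-β * (V (w (n + 1)) (ξ (n + 1)) - V (w n) (ξ (n + 1)))) *
          (∏ k ∈ Finset.range n, P (w k) (ξ (k + 1)) (ξ k)) *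
          hP (w n) (ξ (n + 1)) (ξ n) +
        Real.exp (-β * (V (w (n + 1)) (ξ (n + 1)) - V (w n) (ξ (n + 1)))) *
          P (w n) (ξ n) (ξ (n + 1)) * ih

/-- The acceptance ratio of the coin algorithm for coin value `C = 0` equals
`exp(−β𝒲⁰)` with the Jarzynski-type work
`𝒲⁰ = ∑_{k=0}^{K−1} [V(z̄_{k+1}(z, z̃), ξ_{k+1}) − V(z̄_k(z, z̃), ξ_{k+1})]`,
assuming the schedule symmetry `z̄_k(a,b) = z̄_{K−k}(b,a)` and that each kernel
`P_z` is strictly positive and reversible with respect to the conditional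
Boltzmann density `exp(−βV(z, ·))`. -/
theorem stmt10 (ℓ d : ℕ) (hℓ : 0 < ℓ) (hld : ℓ < d)
    (β : ℝ) (hβ : 0 < β)
    (V : (Fin ℓ → ℝ) → (Fin (d - ℓ) → ℝ) → ℝ)
    (hV : Measurable (Function.uncurry V))
    (P : (Fin ℓ → ℝ) → (Fin (d - ℓ) → ℝ) → (Fin (d - ℓ) → ℝ) → ℝ)
    (hPmeas : Measurable (fun q : (Fin ℓ → ℝ) × (Fin (d - ℓ) → ℝ) × (Fin (d - ℓ) → ℝ) =>
      P q.1 q.2.1 q.2.2))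
    (K : ℕ) (hK : 1 ≤ K)
    (zbar : ℕ → (Fin ℓ → ℝ) → (Fin ℓ → ℝ) → (Fin ℓ → ℝ))
    (hzbarmeas : ∀ k, Measurable (Function.uncurry (zbar k)))
    (hzbar0 : ∀ a b, zbar 0 a b = a)
    (hzbarK : ∀ a b, zbar K a b = b)
    (hzbarsymm : ∀ (a b : Fin ℓ → ℝ) (k : ℕ), k ≤ K → zbar k a b = zbar (K - k) b a)
    (hPpos : ∀ z x y, 0 < P z x y)
    (hPrev : ∀ z x y, P z x y * Real.exp (-β * V z x) = P z y x * Real.exp (-β * V z y)) :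
    ∀ (z z' : Fin ℓ → ℝ) (ξ : ℕ → (Fin (d - ℓ) → ℝ)),
      (Real.exp (-β * V z' (ξ K)) *
          ∏ k ∈ Finset.range K, P (zbar (k + 1) z' z) (ξ (K - k)) (ξ (K - k - 1))) /
        (Real.exp (-β * V z (ξ 0)) *
          ∏ k ∈ Finset.Icc 1 K, P (zbar (k - 1) z z') (ξ (k - 1)) (ξ k)) =
      Real.exp (-β * ∑ k ∈ Finset.range K,
        (V (zbar (k + 1) z z') (ξ (k + 1)) - V (zbar k z z') (ξ (k + 1)))) := by
  intro z z' ξ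
  have hback : ∏ k ∈ Finset.range K, P (zbar (k + 1) z' z) (ξ (K - k)) (ξ (K - k - 1)) =
      ∏ k ∈ Finset.range K, P (zbar k z z') (ξ (k + 1)) (ξ k) := by
    rw [← Finset.prod_range_reflect (fun k => P (zbar k z z') (ξ (k + 1)) (ξ k))]
    refine Finset.prod_congr rfl fun k hk => ?_
    have hk' := Finset.mem_range.mp hk
    rw [hzbarsymm z' z (k + 1) hk', show K - (k + 1) = K - 1 - k by omega,
      show K - k - 1 = K - 1 - k by omega, show K - k = K - 1 - k + 1 by omega]
  have hforw : ∏ k ∈ Finset.Icc 1 K, P (zbar (k - 1) z z') (ξ (k - 1)) (ξ k) =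
      ∏ k ∈ Finset.range K, P (zbar k z z') (ξ k) (ξ (k + 1)) := by
    rw [← Finset.Ico_add_one_right_eq_Icc, Finset.prod_Ico_eq_prod_range]
    simp [add_comm]
  have hpos : 0 < Real.exp (-β * V z (ξ 0)) *
      ∏ k ∈ Finset.range K, P (zbar k z z') (ξ k) (ξ (k + 1)) :=
    mul_pos (Real.exp_pos _) (Finset.prod_pos fun _ _ => hPpos _ _ _)
  rw [hback, hforw, div_eq_iff hpos.ne']
  have hmain := exp_mul_prod_reverse_eq_exp_work_mul β V P hPrev (fun k => zbar k z z') ξ K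
  simpa only [hzbar0, hzbarK] using hmain
end

section
/- Assume the schedule symmetry z̄_k(a, b) = z̄_{K−k}(b, a) for all a, b ∈ ℝ^ℓ and all k ∈ {0, …, K}, and that each kernel is strictly positive and reversible with respect to the conditional Boltzmann densities: P_z(x, y) > 0 and P_z(x, y) exp(−βV(z, x)) = P_z(y, x) exp(−βV(z, y)) for all z ∈ ℝ^ℓ and x, y ∈ ℝ^{d−ℓ}. Then for all z, z̃ ∈ ℝ^ℓ and all ξ₀, …, ξ_{K+1} ∈ ℝ^{d−ℓ}, [ exp(−βV(z̃, ξ_{K+1})) ∏_{k=0}^{K} P_{z̄_k(z̃, z)}(ξ_{K+1−k}, ξ_{K−k}) ] / [ exp(−βV(z, ξ₀)) ∏_{k=0}^{K} P_{z̄_k(z, z̃)}(ξ_k, ξ_{k+1}) ] = exp( −β ∑_{k=1}^{K} [ V(z̄_k(z, z̃), ξ_k) − V(z̄_{k−1}(z, z̃), ξ_k) ] ). In other words, the acceptance ratio of the symmetric path algorithm equals exp(−β𝒲²) where 𝒲² is the Jarzynski-type work along the forward path. -/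
open MeasureTheory

/-- Telescoping of detailed balance along a path: the reversed path weight equals the forward path
weight times the exponential of minus `β` times the work done by the switches of the parameter. -/
theorem exp_mul_prod_reverse_eq_of_detailedBalance {Z X : Type*} (β : ℝ) (V : Z → X → ℝ)
    (P : Z → X → X → ℝ)
    (hP : ∀ z x y, P z x y * Real.exp (-β * V z x) = P z y x * Real.exp (-β * V z y))
    (w : ℕ → Z) (ξ : ℕ → X) (n : ℕ) :
    Real.exp (-β * V (w n) (ξ (n + 1))) *
        ∏ k ∈ Finset.range (n + 1), P (w k) (ξ (k + 1)) (ξ k) =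
      Real.exp (-β * ∑ k ∈ Finset.Icc 1 n, (V (w k) (ξ k) - V (w (k - 1)) (ξ k))) *
        (Real.exp (-β * V (w 0) (ξ 0)) *
          ∏ k ∈ Finset.range (n + 1), P (w k) (ξ k) (ξ (k + 1))) := by
  induction n with
  | zero => simpa [mul_comm] using hP (w 0) (ξ 1) (ξ 0)
  | succ n ih =>
    have hsplit : Real.exp (-β * V (w (n + 1)) (ξ (n + 1))) =
        Real.exp (-β * (V (w (n + 1)) (ξ (n + 1)) - V (w n) (ξ (n + 1)))) *
          Real.exp (-β * V (w n) (ξ (n + 1))) := by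
      rw [← Real.exp_add]
      ring_nf
    have hbal := hP (w (n + 1)) (ξ (n + 1 + 1)) (ξ (n + 1))
    rw [hsplit] at hbal
    rw [Finset.prod_range_succ, Finset.prod_range_succ _ (n + 1),
      Finset.sum_Icc_succ_top (by lia), mul_add, Real.exp_add, Nat.add_sub_cancel]
    linear_combination
      (∏ k ∈ Finset.range (n + 1), P (w k) (ξ (k + 1)) (ξ k)) * hbal +
      P (w (n + 1)) (ξ (n + 1)) (ξ (n + 1 + 1)) *
        Real.exp (-β * (V (w (n + 1)) (ξ (n + 1)) - V (w n) (ξ (n + 1)))) * ih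

/-- The acceptance ratio of the symmetric path algorithm equals `exp(−β𝒲²)`
with the Jarzynski-type work
`𝒲² = ∑_{k=1}^{K} [V(z̄_k(z, z̃), ξ_k) − V(z̄_{k−1}(z, z̃), ξ_k)]`,
assuming the schedule symmetry `z̄_k(a,b) = z̄_{K−k}(b,a)` and that each kernel
`P_z` is strictly positive and reversible with respect to the conditional
Boltzmann density `exp(−βV(z, ·))`. -/
theorem stmt11 (ℓ d : ℕ) (hℓ : 0 < ℓ) (hld : ℓ < d)
    (β : ℝ) (hβ : 0 < β)
    (V : (Fin ℓ → ℝ) → (Fin (d - ℓ) → ℝ) → ℝ)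
    (hV : Measurable (Function.uncurry V))
    (P : (Fin ℓ → ℝ) → (Fin (d - ℓ) → ℝ) → (Fin (d - ℓ) → ℝ) → ℝ)
    (hPmeas : Measurable (fun q : (Fin ℓ → ℝ) × (Fin (d - ℓ) → ℝ) × (Fin (d - ℓ) → ℝ) =>
      P q.1 q.2.1 q.2.2))
    (K : ℕ) (hK : 1 ≤ K)
    (zbar : ℕ → (Fin ℓ → ℝ) → (Fin ℓ → ℝ) → (Fin ℓ → ℝ))
    (hzbarmeas : ∀ k, Measurable (Function.uncurry (zbar k)))
    (hzbar0 : ∀ a b, zbar 0 a b = a)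
    (hzbarK : ∀ a b, zbar K a b = b)
    (hzbarsymm : ∀ (a b : Fin ℓ → ℝ) (k : ℕ), k ≤ K → zbar k a b = zbar (K - k) b a)
    (hPpos : ∀ z x y, 0 < P z x y)
    (hPrev : ∀ z x y, P z x y * Real.exp (-β * V z x) = P z y x * Real.exp (-β * V z y)) :
    ∀ (z z' : Fin ℓ → ℝ) (ξ : ℕ → (Fin (d - ℓ) → ℝ)),
      (Real.exp (-β * V z' (ξ (K + 1))) *
          ∏ k ∈ Finset.range (K + 1), P (zbar k z' z) (ξ (K + 1 - k)) (ξ (K - k))) /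
        (Real.exp (-β * V z (ξ 0)) *
          ∏ k ∈ Finset.range (K + 1), P (zbar k z z') (ξ k) (ξ (k + 1))) =
      Real.exp (-β * ∑ k ∈ Finset.Icc 1 K,
        (V (zbar k z z') (ξ k) - V (zbar (k - 1) z z') (ξ k))) := by
  intro z z' ξ
  have hreflect : ∏ k ∈ Finset.range (K + 1), P (zbar k z' z) (ξ (K + 1 - k)) (ξ (K - k)) =
      ∏ k ∈ Finset.range (K + 1), P (zbar k z z') (ξ (k + 1)) (ξ k) := by
    rw [← Finset.prod_range_reflect (fun k => P (zbar k z z') (ξ (k + 1)) (ξ k))]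
    refine Finset.prod_congr rfl fun k hk => ?_
    have hk' : k ≤ K := Nat.lt_succ_iff.mp (Finset.mem_range.mp hk)
    rw [hzbarsymm z' z k hk', Nat.add_sub_cancel, Nat.sub_add_comm hk']
  have hpos : 0 < Real.exp (-β * V z (ξ 0)) *
      ∏ k ∈ Finset.range (K + 1), P (zbar k z z') (ξ k) (ξ (k + 1)) :=
    mul_pos (Real.exp_pos _) (Finset.prod_pos fun _ _ => hPpos _ _ _)
  have hpath := exp_mul_prod_reverse_eq_of_detailedBalance β V P hPrev (fun k => zbar k z z') ξ K
  simp only [hzbar0, hzbarK] at hpath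
  rw [hreflect, div_eq_iff hpos.ne', hpath]
end

section
/- Fix points ζ₀, …, ζ_K ∈ ℝ^ℓ with K ≥ 1. Assume 0 < ∫ exp(−βV(ζ₀, x)) dx < ∞ and 0 < ∫ exp(−βV(ζ_K, x)) dx < ∞, and that for each k ∈ {1, …, K} the kernel P_{ζ_k} leaves the conditional measure ν_⊥(· | ζ_k) invariant, i.e. ∫ exp(−βV(ζ_k, x)) P_{ζ_k}(x, y) dx = exp(−βV(ζ_k, y)) for almost every y ∈ ℝ^{d−ℓ}. Then for every bounded measurable φ : ℝ^{d−ℓ} → ℝ, ∫_{(ℝ^{d−ℓ})^{K+1}} φ(ξ_K) exp( −β ∑_{k=0}^{K−1} [ V(ζ_{k+1}, ξ_k) − V(ζ_k, ξ_k) ] ) · [ exp(−βV(ζ₀, ξ₀)) / ∫ exp(−βV(ζ₀, x)) dx ] · ∏_{k=1}^{K} P_{ζ_k}(ξ_{k−1}, ξ_k) dξ₀ ⋯ dξ_K = exp( −β (F(ζ_K) − F(ζ₀)) ) ∫_{ℝ^{d−ℓ}} φ(y) ν_⊥(dy | ζ_K). That is, the discrete Jarzynski–Crooks work 𝒲¹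 = ∑_{k=0}^{K−1} [ V(ζ_{k+1}, ξ_k) − V(ζ_k, ξ_k) ], computed along the path where ξ₀ ∼ ν_⊥(· | ζ₀) and ξ_k ∼ P_{ζ_k}(ξ_{k−1}, ·), satisfies the Jarzynski equality E[ φ(ξ_K) exp(−β𝒲¹) ] = exp(−β(F(ζ_K) − F(ζ₀))) ∫ φ dν_⊥(· | ζ_K). -/
open MeasureTheory

/-- Extension of a tuple `η : Fin n → X` to a function on `ℕ` (the value beyond
`n` is irrelevant). -/
def extendPath {X : Type*} [Inhabited X] {n : ℕ} (η : Fin n → X) : ℕ → X :=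
  fun k => if h : k < n then η ⟨k, h⟩ else default

/-- Fubini for the volume on tuples, with the last coordinate split off. -/
theorem lintegral_fin_snoc {X : Type*} [MeasureSpace X] [SigmaFinite (volume : Measure X)]
    {n : ℕ} {f : (Fin (n + 1) → X) → ENNReal} (hf : Measurable f) :
    ∫⁻ ξ, f ξ = ∫⁻ ξ : Fin n → X, ∫⁻ y, f (Fin.snoc ξ y) := by
  have h := (volume_preserving_piFinSuccAbove (fun _ : Fin (n + 1) => X) (Fin.last n)).symm
  have hfm : Measurable fun q : X × (Fin n → X) =>
      f ((MeasurableEquiv.piFinSuccAbove (fun _ : Fin (n + 1) => X) (Fin.last n)).symm q) :=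
    hf.comp (MeasurableEquiv.measurable _)
  rw [← h.lintegral_comp hf, Measure.volume_eq_prod, lintegral_prod_symm' _ hfm]
  simp [MeasurableEquiv.piFinSuccAbove, Fin.insertNthEquiv, Fin.insertNth_last']

theorem extendPath_snoc_of_lt {X : Type*} [Inhabited X] {n k : ℕ} (hk : k < n)
    (ξ : Fin n → X) (y : X) :
    extendPath (Fin.snoc ξ y : Fin (n + 1) → X) k = extendPath ξ k := by
  simp [extendPath, hk, Nat.lt_succ_of_lt hk, Fin.snoc]

theorem extendPath_snoc_self {X : Type*} [Inhabited X] {n : ℕ} (ξ : Fin n → X) (y : X) :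
    extendPath (Fin.snoc ξ y : Fin (n + 1) → X) n = y := by
  simp [extendPath, Fin.snoc]

theorem measurable_extendPath {X : Type*} [Inhabited X] [MeasurableSpace X] {n : ℕ} (k : ℕ) :
    Measurable (fun ξ : Fin n → X => extendPath ξ k) := by
  unfold extendPath
  split_ifs
  · exact measurable_pi_apply _
  · exact measurable_const

/-- If each kernel `p (k + 1)` leaves the density `e (k + 1)` invariant and `r k` reweights `e k`
into `e (k + 1)`, then the last point of the reweighted path has density `e n`. -/
theorem lintegral_reweighted_path {X : Type*} [Inhabited X] [MeasureSpace X]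
    [SigmaFinite (volume : Measure X)] {e r : ℕ → X → ENNReal} {p : ℕ → X → X → ENNReal}
    (he : ∀ k, Measurable (e k)) (hr : ∀ k, Measurable (r k))
    (hp : ∀ k, Measurable (Function.uncurry (p k)))
    (hre : ∀ k x, e k x * r k x = e (k + 1) x) (n : ℕ)
    (hinv : ∀ k < n, ∀ᵐ y, ∫⁻ x, e (k + 1) x * p (k + 1) x y = e (k + 1) y)
    {ψ : X → ENNReal} (hψ : Measurable ψ) :
    ∫⁻ ξ : Fin (n + 1) → X, ψ (extendPath ξ n) * (e 0 (extendPath ξ 0) *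
      ∏ k ∈ Finset.range n,
        (r k (extendPath ξ k) * p (k + 1) (extendPath ξ k) (extendPath ξ (k + 1)))) =
    ∫⁻ y, ψ y * e n y := by
  have hx (m k : ℕ) : Measurable (fun ξ : Fin m → X => extendPath ξ k) := measurable_extendPath k
  have hp' (m k : ℕ) : Measurable
      (fun ξ : Fin m → X => p (k + 1) (extendPath ξ k) (extendPath ξ (k + 1))) :=
    (hp (k + 1)).comp ((hx m k).prodMk (hx m (k + 1)))
  have hmeas (m : ℕ) {g : X → ENNReal} (hg : Measurable g) :
      Measurable (fun ξ : Fin (m + 1) → X => g (extendPath ξ m) * (e 0 (extendPath ξ 0) *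
      ∏ k ∈ Finset.range m,
        (r k (extendPath ξ k) * p (k + 1) (extendPath ξ k) (extendPath ξ (k + 1))))) :=
    (hg.comp (hx _ _)).mul (((he 0).comp (hx _ _)).mul
      (Finset.measurable_fun_prod _ fun k _ => ((hr k).comp (hx _ _)).mul (hp' _ _)))
  induction n generalizing ψ with
  | zero =>
    rw [lintegral_fin_snoc (hmeas 0 hψ), Measure.volume_pi_eq_dirac Fin.elim0, lintegral_dirac]
    simp only [extendPath_snoc_self, Finset.range_zero, Finset.prod_empty, mul_one]
  | succ n ih =>
    have hψp : Measurable (Function.uncurry fun x y => ψ y * p (n + 1) x y) :=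
      (hψ.comp measurable_snd).mul (hp (n + 1))
    have hψpx (x : X) : Measurable fun y => ψ y * p (n + 1) x y :=
      hψp.comp measurable_prodMk_left
    have hep (y : X) : Measurable fun x => e (n + 1) x * p (n + 1) x y :=
      (he _).mul ((hp _).comp measurable_prodMk_right)
    have hg : Measurable fun x => r n x * ∫⁻ y, ψ y * p (n + 1) x y :=
      (hr n).mul hψp.lintegral_prod_right
    rw [lintegral_fin_snoc (hmeas (n + 1) hψ)]
    calc
      _ = ∫⁻ ξ : Fin (n + 1) → X, (r n (extendPath ξ n) *
            ∫⁻ y, ψ y * p (n + 1) (extendPath ξ n) y) * (e 0 (extendPath ξ 0) *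
          ∏ k ∈ Finset.range n,
            (r k (extendPath ξ k) * p (k + 1) (extendPath ξ k) (extendPath ξ (k + 1)))) := by
        refine lintegral_congr fun ξ => ?_
        rw [mul_right_comm, ← lintegral_const_mul _ (hψpx _)]
        refine lintegral_congr fun y => ?_
        rw [Finset.prod_range_succ, extendPath_snoc_self, extendPath_snoc_of_lt n.succ_pos,
          extendPath_snoc_of_lt n.lt_succ_self]
        have hprod : ∏ k ∈ Finset.range n, (r k (extendPath (Fin.snoc ξ y : Fin (n + 2) → X) k) *
              p (k + 1) (extendPath (Fin.snoc ξ y : Fin (n + 2) → X) k)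
                (extendPath (Fin.snoc ξ y : Fin (n + 2) → X) (k + 1))) =
            ∏ k ∈ Finset.range n,
              (r k (extendPath ξ k) * p (k + 1) (extendPath ξ k) (extendPath ξ (k + 1))) := by
          refine Finset.prod_congr rfl fun k hk => ?_
          rw [Finset.mem_range] at hk
          rw [extendPath_snoc_of_lt (Nat.lt_succ_of_lt hk),
            extendPath_snoc_of_lt (Nat.succ_lt_succ hk)]
        rw [hprod]
        ring
      _ = ∫⁻ x, ∫⁻ y, ψ y * (e (n + 1) x * p (n + 1) x y) := by
        rw [ih (fun k hk => hinv k (Nat.lt_succ_of_lt hk)) hg]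
        refine lintegral_congr fun x => ?_
        rw [mul_right_comm, mul_comm (r n x), hre,
          ← lintegral_const_mul _ (hψpx _)]
        exact lintegral_congr fun y => mul_left_comm _ _ _
      _ = ∫⁻ y, ∫⁻ x, ψ y * (e (n + 1) x * p (n + 1) x y) :=
        lintegral_lintegral_swap ((hψ.comp measurable_snd).mul
          (((he (n + 1)).comp measurable_fst).mul (hp (n + 1)))).aemeasurable
      _ = _ := by
        refine lintegral_congr_ae ?_
        filter_upwards [hinv n n.lt_succ_self] with y hy
        rw [lintegral_const_mul _ (hep y), hy]

/-- A nonnegative function whose Bochner integral is nonzero has the same lower integral. -/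
theorem lintegral_ofReal_of_integral_eq_pos {X : Type*} [MeasurableSpace X] {μ : Measure X}
    {f : X → ℝ} {c : ℝ} (hf : ∀ x, 0 ≤ f x) (hc : 0 < c) (h : ∫ x, f x ∂μ = c) :
    ∫⁻ x, ENNReal.ofReal (f x) ∂μ = ENNReal.ofReal c := by
  rw [← h, ofReal_integral_eq_lintegral_ofReal _ (Filter.Eventually.of_forall hf)]
  by_contra hn
  exact hc.ne' (h.symm.trans (integral_undef hn))

/-- Discrete Jarzynski equality for the work
`𝒲¹ = ∑_{k=0}^{K−1} [V(ζ_{k+1}, ξ_k) − V(ζ_k, ξ_k)]` along the path where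
`ξ_0 ∼ ν_⊥(·|ζ_0)` and `ξ_k ∼ P_{ζ_k}(ξ_{k−1}, ·)`:
`E[φ(ξ_K) exp(−β𝒲¹)] = exp(−β(F(ζ_K) − F(ζ_0))) ∫ φ dν_⊥(·|ζ_K)`,
provided each kernel `P_{ζ_k}`, `1 ≤ k ≤ K`, leaves `ν_⊥(·|ζ_k)` invariant. -/
theorem stmt12 (ℓ d : ℕ) (hℓ : 0 < ℓ) (hld : ℓ < d)
    (β : ℝ) (hβ : 0 < β)
    (V : (Fin ℓ → ℝ) → (Fin (d - ℓ) → ℝ) → ℝ)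
    (hV : Measurable (Function.uncurry V))
    (Zc : ℝ)
    (hZc : Zc = ∫ x : (Fin ℓ → ℝ) × (Fin (d - ℓ) → ℝ), Real.exp (-β * V x.1 x.2))
    (hZpos : 0 < Zc)
    (hZfin : Integrable (fun x : (Fin ℓ → ℝ) × (Fin (d - ℓ) → ℝ) =>
      Real.exp (-β * V x.1 x.2)))
    (F : (Fin ℓ → ℝ) → ℝ)
    (hF : ∀ z, F z = -β⁻¹ * Real.log (Zc⁻¹ * ∫ x : Fin (d - ℓ) → ℝ,
      Real.exp (-β * V z x)))
    (P : (Fin ℓ → ℝ) → (Fin (d - ℓ) → ℝ) → (Fin (d - ℓ) → ℝ) → ℝ)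
    (hPmeas : Measurable (fun q : (Fin ℓ → ℝ) × (Fin (d - ℓ) → ℝ) × (Fin (d - ℓ) → ℝ) =>
      P q.1 q.2.1 q.2.2))
    (hPnonneg : ∀ z x y, 0 ≤ P z x y)
    (hPnorm : ∀ z x, (∫ y, P z x y) = 1)
    (K : ℕ) (hK : 1 ≤ K)
    (ζ : ℕ → (Fin ℓ → ℝ))
    (h0pos : 0 < ∫ x : Fin (d - ℓ) → ℝ, Real.exp (-β * V (ζ 0) x))
    (h0fin : Integrable (fun x : Fin (d - ℓ) → ℝ => Real.exp (-β * V (ζ 0) x)))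
    (hKpos : 0 < ∫ x : Fin (d - ℓ) → ℝ, Real.exp (-β * V (ζ K) x))
    (hKfin : Integrable (fun x : Fin (d - ℓ) → ℝ => Real.exp (-β * V (ζ K) x)))
    (hinv : ∀ k, 1 ≤ k → k ≤ K →
      ∀ᵐ y : Fin (d - ℓ) → ℝ,
        (∫ x, Real.exp (-β * V (ζ k) x) * P (ζ k) x y) = Real.exp (-β * V (ζ k) y))
    (φ : (Fin (d - ℓ) → ℝ) → ℝ)
    (hφmeas : Measurable φ) (hφbdd : ∃ C, ∀ x, |φ x| ≤ C) :
    ∫ ξ : Fin (K + 1) → (Fin (d - ℓ) → ℝ),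
        φ (extendPath ξ K) *
          Real.exp (-β * ∑ k ∈ Finset.range K,
            (V (ζ (k + 1)) (extendPath ξ k) - V (ζ k) (extendPath ξ k))) *
          (Real.exp (-β * V (ζ 0) (extendPath ξ 0)) /
            ∫ x : Fin (d - ℓ) → ℝ, Real.exp (-β * V (ζ 0) x)) *
          ∏ k ∈ Finset.Icc 1 K, P (ζ k) (extendPath ξ (k - 1)) (extendPath ξ k) =
      Real.exp (-β * (F (ζ K) - F (ζ 0))) *
        ∫ y : Fin (d - ℓ) → ℝ,
          φ y * (Zc⁻¹ * Real.exp (-β * V (ζ K) y) / Real.exp (-β * F (ζ K))) := by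
  set Z₀ : ℝ := ∫ x : Fin (d - ℓ) → ℝ, Real.exp (-β * V (ζ 0) x) with hZ₀
  have hZcne := hZpos.ne'
  have hVm (k : ℕ) : Measurable (V (ζ k)) := hV.comp measurable_prodMk_left
  have hPm (k : ℕ) : Measurable (Function.uncurry (P (ζ k))) :=
    hPmeas.comp (measurable_const.prodMk measurable_id)
  let e : ℕ → (Fin (d - ℓ) → ℝ) → ℝ := fun k x => Real.exp (-β * V (ζ k) x) / Z₀
  let r : ℕ → (Fin (d - ℓ) → ℝ) → ℝ := fun k x =>
    Real.exp (-β * (V (ζ (k + 1)) x - V (ζ k) x))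
  let W : (Fin (K + 1) → (Fin (d - ℓ) → ℝ)) → ℝ := fun ξ => e 0 (extendPath ξ 0) *
    ∏ k ∈ Finset.range K,
      (r k (extendPath ξ k) * P (ζ (k + 1)) (extendPath ξ k) (extendPath ξ (k + 1)))
  have he0 (k x) : 0 ≤ e k x := by positivity
  have hr0 (k x) : 0 ≤ r k x := by positivity
  have hem (k : ℕ) : Measurable (e k) := (((hVm k).const_mul _).exp).div_const _
  have hrm (k : ℕ) : Measurable (r k) := (((hVm (k + 1)).sub (hVm k)).const_mul _).exp
  have hx (k : ℕ) : Measurable (fun ξ : Fin (K + 1) → (Fin (d - ℓ) → ℝ) => extendPath ξ k) :=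
    measurable_extendPath k
  have hWm : Measurable W := ((hem 0).comp (hx 0)).mul
    (Finset.measurable_fun_prod _ fun k _ =>
      ((hrm k).comp (hx k)).mul ((hPm (k + 1)).comp ((hx k).prodMk (hx (k + 1)))))
  have hW0 (ξ) : 0 ≤ W ξ :=
    mul_nonneg (he0 _ _) (Finset.prod_nonneg fun k _ => mul_nonneg (hr0 _ _) (hPnonneg _ _ _))
  have hre (k x) : e k x * r k x = e (k + 1) x := by
    simp only [e, r]
    rw [div_mul_eq_mul_div, ← Real.exp_add]
    ring_nf
  have hmap : (volume.withDensity fun ξ => ENNReal.ofReal (W ξ)).map (fun ξ => extendPath ξ K) =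
      volume.withDensity fun y => ENNReal.ofReal (e K y) := by
    refine Measure.ext_of_lintegral _ fun ψ hψ => ?_
    have hψx : Measurable fun ξ : Fin (K + 1) → (Fin (d - ℓ) → ℝ) => ψ (extendPath ξ K) :=
      hψ.comp (hx K)
    rw [lintegral_map hψ (hx K), lintegral_withDensity_eq_lintegral_mul _ hWm.ennreal_ofReal hψx,
      lintegral_withDensity_eq_lintegral_mul _ (hem K).ennreal_ofReal hψ]
    have h := lintegral_reweighted_path (e := fun k x => ENNReal.ofReal (e k x))
      (r := fun k x => ENNReal.ofReal (r k x))
      (p := fun k x y => ENNReal.ofReal (P (ζ k) x y))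
      (fun k => (hem k).ennreal_ofReal) (fun k => (hrm k).ennreal_ofReal)
      (fun k => (hPm k).ennreal_ofReal)
      (fun k x => by rw [← ENNReal.ofReal_mul (he0 _ _), hre]) K (fun k hk => ?_) hψ
    · simp only [Pi.mul_apply, mul_comm _ (ψ _)]
      rw [← h]
      refine lintegral_congr fun ξ => ?_
      simp only [W]
      rw [ENNReal.ofReal_mul (he0 _ _), ENNReal.ofReal_prod_of_nonneg
        fun k _ => mul_nonneg (hr0 _ _) (hPnonneg _ _ _)]
      simp only [ENNReal.ofReal_mul (hr0 _ _)]
    · filter_upwards [hinv (k + 1) k.succ_pos hk] with y hy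
      simp only [← ENNReal.ofReal_mul (he0 _ _)]
      refine lintegral_ofReal_of_integral_eq_pos
        (fun x => mul_nonneg (he0 _ _) (hPnonneg _ _ _)) (by positivity) ?_
      simp only [e, div_mul_eq_mul_div]
      rw [integral_div, hy]
  have hF0 : Real.exp (-β * F (ζ 0)) = Zc⁻¹ * Z₀ := by
    rw [hF, ← mul_assoc, neg_mul_neg, mul_inv_cancel₀ hβ.ne', one_mul, Real.exp_log (by positivity)]
  calc
    _ = ∫ ξ, (ENNReal.ofReal (W ξ)).toReal • φ (extendPath ξ K) := by
      refine integral_congr_ae (Filter.Eventually.of_forall fun ξ => ?_)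
      simp only [ENNReal.toReal_ofReal (hW0 ξ), W, e, r, smul_eq_mul]
      rw [Finset.prod_mul_distrib, ← Real.exp_sum, ← Finset.mul_sum,
        ← Finset.Ico_succ_right_eq_Icc, Finset.prod_Ico_eq_prod_range]
      simp only [Nat.succ_eq_succ, Nat.succ_eq_add_one, add_tsub_cancel_right, add_comm 1]
      ring
    _ = ∫ y, φ y ∂(volume.withDensity fun y => ENNReal.ofReal (e K y)) := by
      rw [← integral_withDensity_eq_integral_toReal_smul hWm.ennreal_ofReal
        (Filter.Eventually.of_forall fun _ => ENNReal.ofReal_lt_top), ← hmap,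
        integral_map (hx K).aemeasurable hφmeas.aestronglyMeasurable]
    _ = ∫ y, e K y * φ y := by
      rw [integral_withDensity_eq_integral_toReal_smul (hem K).ennreal_ofReal
        (Filter.Eventually.of_forall fun _ => ENNReal.ofReal_lt_top)]
      simp only [ENNReal.toReal_ofReal (he0 _ _), smul_eq_mul]
    _ = _ := by
      rw [← integral_const_mul]
      refine integral_congr_ae (Filter.Eventually.of_forall fun y => ?_)
      have hexp : Real.exp (-β * (F (ζ K) - F (ζ 0))) =
          Real.exp (-β * F (ζ K)) / (Zc⁻¹ * Z₀) := by
        rw [mul_sub, Real.exp_sub, hF0]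
      simp only [hexp, e]
      field_simp
end
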